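/- arXiv:2106.14630 — 5 statements merged into one kernel-verified Lean document; each statement's English description precedes it below -/
import Mathlib

section
/- (Key deterministic inequality of Proposition 1) Fix j ∈ [M]. Suppose f_j* : ℝ → ℝ is nondecreasing and L_j-Lipschitz, u_j* is a unit vector with at most s_j* nonzero entries, and (1/T)‖X_{−T}u‖₂² ≤ β‖u‖₂² holds for every unit vector u ∈ ℝ^M with at most s_j + s_j* nonzero entries. Then for every unit vector û ∈ ℝ^M with at most s_j nonzero entries, (1/√T)·‖iso_{X_{−T}û}(X_{−0,j}) − f_j*(X_{−T}u_j*)‖₂ ≤ (1/√T)·‖iso_{X_{−T}û}(X_{−0,j}) − iso_{X_{−T}û}(f_j*(X_{−T}u_j*))‖₂ + L_j·√β·‖û − u_j*‖₂. -/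
open MeasureTheory

noncomputable section

/-- The number of nonzero entries (the "ℓ₀ norm") of a vector. -/
def sparsity {M : ℕ} (u : Fin M → ℝ) : ℕ := Set.ncard {i | u i ≠ 0}

/-- `IsIsoProj v w x` means `x` is the isotonic regression of `w` with respect to the
partial ordering induced by `v`, i.e. the Euclidean projection of `w` onto the closed
convex cone `C_v = {x | x i ≤ x j whenever v i ≤ v j}`. -/
def IsIsoProj {T : ℕ} (v w x : Fin T → ℝ) : Prop :=
  (∀ i j, v i ≤ v j → x i ≤ x j) ∧
  ∀ y : Fin T → ℝ, (∀ i j, v i ≤ v j → y i ≤ y j) →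
    ∑ t, (w t - x t) ^ 2 ≤ ∑ t, (w t - y t) ^ 2

/-- `IsHardThresh s x y` means `y` is a hard-thresholding of `x` at sparsity level `s`:
`y` minimizes the Euclidean distance to `x` among all vectors with at most `s`
nonzero entries (i.e. `y` keeps `s` largest-magnitude entries of `x`). -/
def IsHardThresh {M : ℕ} (s : ℕ) (x y : Fin M → ℝ) : Prop :=
  sparsity y ≤ s ∧ ∀ z : Fin M → ℝ, sparsity z ≤ s →
    ∑ i, (y i - x i) ^ 2 ≤ ∑ i, (z i - x i) ^ 2

theorem sparsity_sub_le {M : ℕ} (u v : Fin M → ℝ) :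
    sparsity (u - v) ≤ sparsity u + sparsity v := by
  refine le_trans (Set.ncard_le_ncard ?_ (Set.toFinite _)) (Set.ncard_union_le _ _)
  intro i hi
  by_contra h
  simp only [Set.mem_union, Set.mem_ofPred_eq, not_or, not_not] at h
  exact hi (by simp [h.1, h.2])

theorem sparsity_const_mul_le {M : ℕ} (c : ℝ) (u : Fin M → ℝ) :
    sparsity (fun i => c * u i) ≤ sparsity u :=
  Set.ncard_le_ncard (fun _ hi => right_ne_zero_of_mul hi) (Set.toFinite _)

theorem sqrt_sum_sub_sq_triangle {ι : Type*} [Fintype ι] (a b c : ι → ℝ) :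
    Real.sqrt (∑ t, (a t - c t) ^ 2) ≤
      Real.sqrt (∑ t, (a t - b t) ^ 2) + Real.sqrt (∑ t, (b t - c t) ^ 2) := by
  simpa [EuclideanSpace.dist_eq, Real.dist_eq, sq_abs] using
    dist_triangle (WithLp.toLp 2 a) (WithLp.toLp 2 b) (WithLp.toLp 2 c)

/-- A bound on the quadratic form at sparse unit vectors extends to all sparse vectors
by homogeneity. -/
theorem sum_sq_le_of_sparse_unit {T M : ℕ} (X : Fin T → Fin M → ℝ) (k : ℕ) (β : ℝ)
    (h : ∀ v : Fin M → ℝ, ∑ i, v i ^ 2 = 1 → sparsity v ≤ k →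
      (1 / (T : ℝ)) * ∑ t, (∑ i, X t i * v i) ^ 2 ≤ β)
    (d : Fin M → ℝ) (hd : sparsity d ≤ k) :
    (1 / (T : ℝ)) * ∑ t, (∑ i, X t i * d i) ^ 2 ≤ β * ∑ i, d i ^ 2 := by
  have hn : 0 ≤ ∑ i, d i ^ 2 := Finset.sum_nonneg fun i _ => sq_nonneg _
  rcases hn.eq_or_lt with h0 | hpos
  · have hz : ∀ i, d i = 0 := fun i =>
      pow_eq_zero_iff two_ne_zero |>.1
        ((Finset.sum_eq_zero_iff_of_nonneg fun i _ => sq_nonneg (d i)).1 h0.symm i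
          (Finset.mem_univ i))
    simp [hz]
  · set r := Real.sqrt (∑ i, d i ^ 2) with hr
    have hr2 : r ^ 2 = ∑ i, d i ^ 2 := Real.sq_sqrt hn
    have hrpos : 0 < r := Real.sqrt_pos.2 hpos
    have hb := h (fun i => r⁻¹ * d i)
      (by simp only [mul_pow, ← Finset.mul_sum, ← hr2]; field_simp)
      ((sparsity_const_mul_le _ _).trans hd)
    have hlin : ∀ t, ∑ i, X t i * (r⁻¹ * d i) = r⁻¹ * ∑ i, X t i * d i := fun t => by
      rw [Finset.mul_sum]; exact Finset.sum_congr rfl fun i _ => by ring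
    simp only [hlin, mul_pow, ← Finset.mul_sum] at hb
    rw [← hr2]
    calc (1 / (T : ℝ)) * ∑ t, (∑ i, X t i * d i) ^ 2
        = (1 / (T : ℝ) * ((r⁻¹) ^ 2 * ∑ t, (∑ i, X t i * d i) ^ 2)) * r ^ 2 := by
          field_simp
      _ ≤ β * r ^ 2 := by gcongr

/-- (Key deterministic inequality of Proposition 1)
For every unit vector û with at most s_j nonzero entries,
(1/√T)‖iso_{Xû}(X_{−0,j}) − f_j*(Xu_j*)‖₂ ≤
(1/√T)‖iso_{Xû}(X_{−0,j}) − iso_{Xû}(f_j*(Xu_j*))‖₂ + L_j·√β·‖û − u_j*‖₂. -/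
theorem prediction_error_triangle {T M : ℕ}
    (X : Fin T → Fin M → ℝ) (y : Fin T → ℝ)
    (f : ℝ → ℝ) (hfmono : Monotone f)
    (L : ℝ) (hflip : ∀ a b : ℝ, |f a - f b| ≤ L * |a - b|)
    (ustar : Fin M → ℝ) (sstar s : ℕ)
    (hunorm : ∑ i, ustar i ^ 2 = 1) (husparse : sparsity ustar ≤ sstar)
    (β : ℝ)
    (heig : ∀ v : Fin M → ℝ, ∑ i, v i ^ 2 = 1 → sparsity v ≤ s + sstar →
      (1 / (T : ℝ)) * ∑ t, (∑ i, X t i * v i) ^ 2 ≤ β) :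
    ∀ uhat : Fin M → ℝ, ∑ i, uhat i ^ 2 = 1 → sparsity uhat ≤ s →
    ∀ g1 g2 : Fin T → ℝ,
      IsIsoProj (fun t => ∑ i, X t i * uhat i) y g1 →
      IsIsoProj (fun t => ∑ i, X t i * uhat i) (fun t => f (∑ i, X t i * ustar i)) g2 →
      (1 / Real.sqrt (T : ℝ)) * Real.sqrt (∑ t, (g1 t - f (∑ i, X t i * ustar i)) ^ 2) ≤
        (1 / Real.sqrt (T : ℝ)) * Real.sqrt (∑ t, (g1 t - g2 t) ^ 2) +
          L * Real.sqrt β * Real.sqrt (∑ i, (uhat i - ustar i) ^ 2) := by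
  intro uhat hu hus g1 g2 _ hg2
  have hL : 0 ≤ L := by
    have := (abs_nonneg _).trans (hflip 1 0)
    simpa using this
  have hβ : 0 ≤ β :=
    le_trans (by positivity) (heig uhat hu (hus.trans (Nat.le_add_right _ _)))
  have hquad := sum_sq_le_of_sparse_unit X _ β heig (uhat - ustar)
    ((sparsity_sub_le _ _).trans (add_le_add hus husparse))
  have hlip : ∑ t, (f (∑ i, X t i * ustar i) - g2 t) ^ 2 ≤
      L ^ 2 * ∑ t, (∑ i, X t i * (uhat - ustar) i) ^ 2 := by
    refine (hg2.2 (fun t => f (∑ i, X t i * uhat i)) fun i j hij => hfmono hij).trans ?_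
    rw [Finset.mul_sum]
    refine Finset.sum_le_sum fun t _ => ?_
    have ht : ∑ i, X t i * (uhat - ustar) i =
        ∑ i, X t i * uhat i - ∑ i, X t i * ustar i := by
      simp [mul_sub, Finset.sum_sub_distrib]
    rw [ht, ← mul_pow, ← sq_abs]
    have hab := hflip (∑ i, X t i * ustar i) (∑ i, X t i * uhat i)
    calc _ ≤ (L * |∑ i, X t i * ustar i - ∑ i, X t i * uhat i|) ^ 2 := by gcongr
      _ = _ := by rw [mul_pow, sq_abs]; ring
  have hproj : 1 / Real.sqrt (T : ℝ) *
      Real.sqrt (∑ t, (g2 t - f (∑ i, X t i * ustar i)) ^ 2) ≤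
        L * Real.sqrt β * Real.sqrt (∑ i, (uhat i - ustar i) ^ 2) := by
    have hsq : 1 / (T : ℝ) * ∑ t, (g2 t - f (∑ i, X t i * ustar i)) ^ 2 ≤
        L ^ 2 * (β * ∑ i, (uhat i - ustar i) ^ 2) := by
      simp only [sub_sq_comm (g2 _)]
      calc _ ≤ 1 / (T : ℝ) * (L ^ 2 * ∑ t, (∑ i, X t i * (uhat - ustar) i) ^ 2) := by gcongr
        _ = L ^ 2 * (1 / (T : ℝ) * ∑ t, (∑ i, X t i * (uhat - ustar) i) ^ 2) := by ring
        _ ≤ _ := mul_le_mul_of_nonneg_left hquad (sq_nonneg L)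
    have := Real.sqrt_le_sqrt hsq
    rwa [Real.sqrt_mul (by positivity), Real.sqrt_mul (sq_nonneg L), Real.sqrt_sq hL,
      Real.sqrt_mul hβ, Real.sqrt_div zero_le_one, Real.sqrt_one, ← mul_assoc] at this
  calc _ ≤ 1 / Real.sqrt (T : ℝ) * (Real.sqrt (∑ t, (g1 t - g2 t) ^ 2) +
        Real.sqrt (∑ t, (g2 t - f (∑ i, X t i * ustar i)) ^ 2)) := by
        gcongr
        exact sqrt_sum_sub_sq_triangle g1 g2 _
    _ ≤ _ := by rw [mul_add]; gcongr
end
end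

section
/- (Lemma: iterative guarantee) Fix j ∈ [M] and an iteration step k ≥ 1 of the algorithm with step size η_j = 1/(L_jβ). Suppose the Lipschitz, identifiability, and eigenvalue-boundedness assumptions hold, and that ⟨u_j^(k−1), u_j*⟩ ≥ 0. Then for every δ_j > 0, (1 − √(s_j*/s_j) − α_jδ_j/(L_j²β))·‖u_j^(k) − u_j*‖₂² ≤ (1 − α_j/(L_j²β))·‖u_j^(k−1) − u_j*‖₂² + ε_j²/(L_j²β) + C(Z_j, u_j^(k−1))²/(δ_jα_jβ). -/
open MeasureTheory

noncomputable section

/-- First-order optimality of the isotonic regression along a feasible direction. -/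
theorem IsIsoProj.sum_mul_nonpos {T : ℕ} {v w x d : Fin T → ℝ} (h : IsIsoProj v w x)
    (hd : ∀ᶠ e : ℝ in nhdsWithin 0 (Set.Ioi 0), ∀ i j, v i ≤ v j →
      x i + e * d i ≤ x j + e * d j) :
    ∑ t, (w t - x t) * d t ≤ 0 := by
  have key : ∀ᶠ e : ℝ in nhdsWithin 0 (Set.Ioi 0),
      2 * ∑ t, (w t - x t) * d t ≤ e * ∑ t, d t ^ 2 := by
    filter_upwards [hd, self_mem_nhdsWithin] with e he hpos
    have hpos' : 0 < e := hpos
    have h2 := h.2 (fun t => x t + e * d t) he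
    have hexp : ∑ t, (w t - (x t + e * d t)) ^ 2 =
        ∑ t, (w t - x t) ^ 2 - e * (2 * ∑ t, (w t - x t) * d t) + e * (e * ∑ t, d t ^ 2) := by
      simp only [Finset.mul_sum, ← Finset.sum_sub_distrib, ← Finset.sum_add_distrib]
      exact Finset.sum_congr rfl fun t _ => by ring
    rw [hexp] at h2
    exact le_of_mul_le_mul_left (by linarith) hpos'
  have hlim : Filter.Tendsto (fun e : ℝ => e * ∑ t, d t ^ 2) (nhdsWithin 0 (Set.Ioi 0))
      (nhds 0) := by
    have : Filter.Tendsto (fun e : ℝ => e * ∑ t, d t ^ 2) (nhds 0)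
        (nhds (0 * ∑ t, d t ^ 2)) := (continuous_id.mul continuous_const).tendsto 0
    rw [zero_mul] at this
    exact this.mono_left nhdsWithin_le_nhds
  have := ge_of_tendsto hlim key
  linarith

/-- The residual of an isotonic regression is orthogonal to every function of the fit. -/
theorem IsIsoProj.sum_mul_comp_eq_zero {T : ℕ} {v w x : Fin T → ℝ} (h : IsIsoProj v w x)
    (g : ℝ → ℝ) : ∑ t, (w t - x t) * g (x t) = 0 := by
  have key : ∀ g : ℝ → ℝ, ∑ t, (w t - x t) * g (x t) ≤ 0 := by
    intro g
    refine h.sum_mul_nonpos (d := fun t => g (x t)) (Filter.Eventually.filter_mono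
      nhdsWithin_le_nhds ?_)
    refine Filter.eventually_all.2 fun i => Filter.eventually_all.2 fun j => ?_
    rcases lt_trichotomy (x i) (x j) with hij | hij | hij
    · have : ∀ᶠ e : ℝ in nhds 0, x i + e * g (x i) < x j + e * g (x j) := by
        apply ContinuousAt.eventually_lt
        · fun_prop
        · fun_prop
        · simpa using hij
      exact this.mono fun e he _ => he.le
    · exact Filter.Eventually.of_forall fun e _ => by rw [hij]
    · exact Filter.Eventually.of_forall fun e hv => absurd (h.1 i j hv) (not_le.2 hij)
  refine le_antisymm (key g) ?_
  have := key fun c => - g c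
  simp only [mul_neg, Finset.sum_neg_distrib] at this
  linarith

theorem IsIsoProj.sum_mul_self_nonpos {T : ℕ} {v w x : Fin T → ℝ} (h : IsIsoProj v w x) :
    ∑ t, (w t - x t) * v t ≤ 0 := by
  refine h.sum_mul_nonpos ?_
  filter_upwards [self_mem_nhdsWithin] with e he i j hv
  have he' : 0 < e := he
  have := h.1 i j hv
  have := mul_le_mul_of_nonneg_left hv he'.le
  linarith

/-- Every value of the isotonic fit of `f ∘ z` is attained by the continuous function `f`. -/
theorem IsIsoProj.exists_eq_apply {T : ℕ} {v z x : Fin T → ℝ} {f : ℝ → ℝ}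
    (h : IsIsoProj v (fun t => f (z t)) x) (hf : Continuous f) (t : Fin T) :
    ∃ ξ, f ξ = x t := by
  classical
  have h0 := h.sum_mul_comp_eq_zero (fun c => if c = x t then 1 else 0)
  simp only [mul_ite, mul_one, mul_zero, ← Finset.sum_filter] at h0
  have hne : (Finset.univ.filter fun t' => x t' = x t).Nonempty := ⟨t, by simp⟩
  have hmem : x t ∈ Set.range f := by
    apply mem_range_of_exists_le_of_exists_ge hf
    · by_contra! hlt
      refine absurd h0 (Finset.sum_pos (fun t' ht' => ?_) hne).ne'
      rw [(Finset.mem_filter.1 ht').2]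
      linarith [hlt (z t')]
    · by_contra! hlt
      refine absurd h0 (Finset.sum_neg (fun t' ht' => ?_) hne).ne
      rw [(Finset.mem_filter.1 ht').2]
      linarith [hlt (z t')]
  exact hmem

/-- Co-coercivity of the residual of the isotonic regression of `f ∘ z`, for `f` nondecreasing
and `L`-Lipschitz. -/
theorem IsIsoProj.sum_sq_le {T : ℕ} {v z x : Fin T → ℝ} {f : ℝ → ℝ} {L : ℝ}
    (h : IsIsoProj v (fun t => f (z t)) x) (hf : Continuous f) (hmono : Monotone f)
    (hlip : ∀ a b : ℝ, |f a - f b| ≤ L * |a - b|) :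
    ∑ t, (f (z t) - x t) ^ 2 ≤ L * ∑ t, (f (z t) - x t) * z t := by
  have hm : Monotone fun a => L * a - f a := by
    intro a b hab
    have := hlip b a
    rw [abs_of_nonneg (sub_nonneg.2 hab)] at this
    have := (le_abs_self _).trans this
    simp only
    linarith
  choose! ξ hξ using fun c (hc : ∃ t, x t = c) =>
    show ∃ a, f a = c from hc.elim fun t ht => ht ▸ h.exists_eq_apply hf t
  have h1 := h.sum_mul_comp_eq_zero fun c => L * ξ c - f (ξ c)
  have h2 := h.sum_mul_comp_eq_zero id
  have h3 : 0 ≤ ∑ t, (f (z t) - x t) * ((L * z t - f (z t)) - (L * ξ (x t) - f (ξ (x t)))) := by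
    refine Finset.sum_nonneg fun t _ => ?_
    have hx := hξ (x t) ⟨t, rfl⟩
    rcases le_total (z t) (ξ (x t)) with hz | hz
    · refine mul_nonneg_of_nonpos_of_nonpos ?_ ?_
      · have := hmono hz; linarith
      · have := hm hz; simp only at this; linarith
    · refine mul_nonneg ?_ ?_
      · have := hmono hz; linarith
      · have := hm hz; simp only at this; linarith
  have h4 : ∑ t, (f (z t) - x t) * ((L * z t - f (z t)) - (L * ξ (x t) - f (ξ (x t)))) =
      L * ∑ t, (f (z t) - x t) * z t - ∑ t, (f (z t) - x t) ^ 2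
        - ∑ t, (f (z t) - x t) * id (x t)
        - ∑ t, (f (z t) - x t) * (L * ξ (x t) - f (ξ (x t))) := by
    simp only [Finset.mul_sum, ← Finset.sum_sub_distrib, id]
    exact Finset.sum_congr rfl fun t _ => by ring
  linarith

/-- An isotonic vector is a nondecreasing function of the vector inducing the order. -/
theorem exists_monotone_comp_eq {T : ℕ} {v x : Fin T → ℝ}
    (h : ∀ i j, v i ≤ v j → x i ≤ x j) : ∃ g : ℝ → ℝ, Monotone g ∧ ∀ t, g (v t) = x t := by
  let F : ℝ → ℝ := fun c => if hc : ∃ t, v t = c then x hc.choose else 0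
  have hF : ∀ t, F (v t) = x t := by
    intro t
    have hc : ∃ t', v t' = v t := ⟨t, rfl⟩
    simp only [F, dif_pos hc]
    exact le_antisymm (h _ _ hc.choose_spec.le) (h _ _ hc.choose_spec.ge)
  have hmono : MonotoneOn F (Set.range v) := by
    rintro _ ⟨i, rfl⟩ _ ⟨j, rfl⟩ hij
    rw [hF, hF]
    exact h i j hij
  have hfin : (F '' Set.range v).Finite := (Set.finite_range v).image F
  obtain ⟨g, hg, hEq⟩ := hmono.exists_monotone_extension hfin.bddBelow hfin.bddAbove
  exact ⟨g, hg, fun t => by rw [← hF t]; exact (hEq ⟨t, rfl⟩).symm⟩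

theorem sparsity_eq_card {M : ℕ} (u : Fin M → ℝ) :
    sparsity u = (Finset.univ.filter fun i => u i ≠ 0).card := by
  rw [sparsity, Set.ncard_eq_toFinset_card']
  congr 1
  ext i
  simp

theorem sparsity_le_card {M : ℕ} {u : Fin M → ℝ} {S : Finset (Fin M)}
    (h : ∀ i, i ∉ S → u i = 0) : sparsity u ≤ S.card := by
  rw [sparsity_eq_card]
  refine Finset.card_le_card fun i hi => ?_
  by_contra hS
  exact (Finset.mem_filter.1 hi).2 (h i hS)

theorem sparsity_le_add_add {M : ℕ} {u a b c : Fin M → ℝ}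
    (h : ∀ i, a i = 0 → b i = 0 → c i = 0 → u i = 0) :
    sparsity u ≤ sparsity a + sparsity b + sparsity c := by
  classical
  rw [sparsity_eq_card a, sparsity_eq_card b, sparsity_eq_card c]
  refine (sparsity_le_card (S := (Finset.univ.filter (a · ≠ 0) ∪ Finset.univ.filter (b · ≠ 0)) ∪
    Finset.univ.filter (c · ≠ 0)) fun i hi => ?_).trans
    ((Finset.card_union_le _ _).trans (Nat.add_le_add_right (Finset.card_union_le _ _) _))
  simp only [Finset.mem_union, Finset.mem_filter, Finset.mem_univ, true_and, not_or,
    not_not] at hi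
  exact h i hi.1.1 hi.1.2 hi.2

theorem Finset.sum_eq_add_sum_erase_sub {ι : Type*} [Fintype ι] [DecidableEq ι] (i : ι)
    (F G : ι → ℝ) (h : ∀ k, k ≠ i → F k = G k) :
    ∑ k, F k = ∑ k, G k + (F i - G i) := by
  rw [← Finset.add_sum_erase _ F (Finset.mem_univ i), ← Finset.add_sum_erase _ G
    (Finset.mem_univ i), Finset.sum_congr rfl fun k hk => h k (Finset.ne_of_mem_erase hk)]
  ring

/-- Changing one entry of a hard-thresholded vector within the sparsity budget cannot bring it
closer to the input. -/
theorem IsHardThresh.apply_eq_of_sparsity_update_le {M s : ℕ} {x y : Fin M → ℝ}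
    (h : IsHardThresh s x y) (i : Fin M)
    (hs : sparsity (Function.update y i (x i)) ≤ s) : y i = x i := by
  have h1 := h.2 _ hs
  rw [Finset.sum_eq_add_sum_erase_sub i (fun k => (Function.update y i (x i) k - x k) ^ 2)
    (fun k => (y k - x k) ^ 2) fun k hk => by simp [Function.update_of_ne hk]] at h1
  simp only [Function.update_self, sub_self] at h1
  have : (y i - x i) ^ 2 = 0 := le_antisymm (by linarith) (sq_nonneg _)
  exact sub_eq_zero.1 (pow_eq_zero_iff two_ne_zero |>.1 this)

theorem IsHardThresh.apply_eq_of_ne_zero {M s : ℕ} {x y : Fin M → ℝ}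
    (h : IsHardThresh s x y) {i : Fin M} (hi : y i ≠ 0) : y i = x i := by
  refine h.apply_eq_of_sparsity_update_le i (le_trans ?_ h.1)
  rw [sparsity_eq_card y]
  refine sparsity_le_card fun k hk => ?_
  have hk0 : y k = 0 := by simpa using hk
  rw [Function.update_of_ne (by rintro rfl; exact hi hk0), hk0]

theorem IsHardThresh.eq_of_sparsity_lt {M s : ℕ} {x y : Fin M → ℝ}
    (h : IsHardThresh s x y) (hs : sparsity y < s) (i : Fin M) : y i = x i := by
  classical
  refine h.apply_eq_of_sparsity_update_le i (le_trans ?_ hs)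
  rw [sparsity_eq_card y]
  refine (sparsity_le_card (S := insert i (Finset.univ.filter (y · ≠ 0))) fun k hk => ?_).trans
    (Finset.card_insert_le _ _)
  simp only [Finset.mem_insert, Finset.mem_filter, Finset.mem_univ, true_and, not_or,
    not_not] at hk
  rw [Function.update_of_ne hk.1, hk.2]

theorem IsHardThresh.abs_le_abs {M s : ℕ} {x y : Fin M → ℝ}
    (h : IsHardThresh s x y) {i j : Fin M} (hi : y i ≠ 0) (hj : y j = 0) : |x j| ≤ |y i| := by
  classical
  have hij : j ≠ i := by rintro rfl; exact hi hj
  have hs : sparsity (Function.update (Function.update y i 0) j (x j)) ≤ s := by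
    refine le_trans ?_ h.1
    rw [sparsity_eq_card y]
    refine (sparsity_le_card (S := insert j ((Finset.univ.filter (y · ≠ 0)).erase i))
      fun k hk => ?_).trans ((Finset.card_insert_le _ _).trans
        (Finset.card_erase_add_one (by simpa using hi)).le)
    simp only [Finset.mem_insert, Finset.mem_erase, Finset.mem_filter, Finset.mem_univ, true_and,
      not_or, not_and, not_not] at hk
    rw [Function.update_of_ne hk.1]
    by_cases hki : k = i
    · rw [hki, Function.update_self]
    · rw [Function.update_of_ne hki, hk.2 hki]
  have h1 := h.2 _ hs
  rw [Finset.sum_eq_add_sum_erase_sub j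
      (fun k => (Function.update (Function.update y i 0) j (x j) k - x k) ^ 2)
      (fun k => (Function.update y i 0 k - x k) ^ 2) fun k hk => by
        simp [Function.update_of_ne hk],
    Finset.sum_eq_add_sum_erase_sub i
      (fun k => (Function.update y i 0 k - x k) ^ 2)
      (fun k => (y k - x k) ^ 2) fun k hk => by simp [Function.update_of_ne hk]] at h1
  simp only [Function.update_self, Function.update_of_ne hij, hj,
    h.apply_eq_of_ne_zero hi] at h1
  rw [h.apply_eq_of_ne_zero hi]
  exact sq_le_sq.1 (by nlinarith)

/-- Relative concavity of hard thresholding. -/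
theorem IsHardThresh.two_mul_sum_le {M s : ℕ} {x y z : Fin M → ℝ} (h : IsHardThresh s x y)
    (hs : 0 < s) (hz : sparsity z ≤ s) :
    2 * ∑ i, (z i - y i) * (x i - y i) ≤
      Real.sqrt ((sparsity z : ℝ) / s) * ∑ i, (y i - z i) ^ 2 := by
  classical
  have hρ := Real.sqrt_nonneg ((sparsity z : ℝ) / s)
  rcases h.1.lt_or_eq with hlt | heq
  · have : ∑ i, (z i - y i) * (x i - y i) = 0 :=
      Finset.sum_eq_zero fun i _ => by rw [h.eq_of_sparsity_lt hlt i]; ring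
    rw [this, mul_zero]
    exact mul_nonneg hρ (Finset.sum_nonneg fun i _ => sq_nonneg _)
  set S := Finset.univ.filter fun i => y i ≠ 0 with hS
  set A := Finset.univ.filter fun i => z i ≠ 0 with hA
  have hScard : S.card = s := by rw [hS, ← sparsity_eq_card, heq]
  have hAcard : A.card = sparsity z := by rw [hA, ← sparsity_eq_card]
  obtain ⟨m, hmS, hmin⟩ := Finset.exists_min_image S (fun i => |y i|)
    (Finset.card_pos.1 (hScard ▸ hs))
  set τ := |y m| with hτ
  have hτ0 : 0 ≤ τ := abs_nonneg _
  have hm0 : y m ≠ 0 := (Finset.mem_filter.1 hmS).2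
  have hinner : ∑ i, (z i - y i) * (x i - y i) ≤ τ * ∑ i ∈ A \ S, |z i| := by
    rw [Finset.mul_sum, ← Finset.sum_subset (Finset.subset_univ (A \ S))]
    · refine Finset.sum_le_sum fun i hi => ?_
      have hyi : y i = 0 := by simpa [hS, hA] using (Finset.mem_sdiff.1 hi).2
      rw [hyi, sub_zero, sub_zero, mul_comm τ]
      refine (le_abs_self _).trans ?_
      rw [abs_mul]
      exact mul_le_mul_of_nonneg_left (h.abs_le_abs hm0 hyi) (abs_nonneg _)
    · intro i _ hi
      by_cases hyi : y i = 0
      · have hzi : z i = 0 := by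
          by_contra hzi
          exact hi (by simp [hS, hA, hyi, hzi])
        rw [hyi, hzi]; ring
      · rw [h.apply_eq_of_ne_zero hyi]; ring
  set B := ∑ i ∈ A \ S, z i ^ 2 with hB
  have hB0 : 0 ≤ B := Finset.sum_nonneg fun i _ => sq_nonneg _
  have hcs : (∑ i ∈ A \ S, |z i|) ^ 2 ≤ (A \ S).card * B := by
    refine sq_sum_le_card_mul_sum_sq.trans_eq ?_
    simp [hB, sq_abs]
  have hnorm : B + (S \ A).card * τ ^ 2 ≤ ∑ i, (y i - z i) ^ 2 := by
    have hdisj : Disjoint (A \ S) (S \ A) := disjoint_sdiff_sdiff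
    refine le_trans ?_ (Finset.sum_le_sum_of_subset_of_nonneg
      (Finset.subset_univ (A \ S ∪ S \ A)) fun i _ _ => sq_nonneg _)
    rw [Finset.sum_union hdisj]
    refine add_le_add (Finset.sum_le_sum fun i hi => ?_) ?_
    · have hyi : y i = 0 := by simpa [hS, hA] using (Finset.mem_sdiff.1 hi).2
      rw [hyi]; nlinarith
    · rw [← nsmul_eq_mul]
      refine Finset.card_nsmul_le_sum _ _ _ fun i hi => ?_
      have hzi : z i = 0 := by simpa [hS, hA] using (Finset.mem_sdiff.1 hi).2
      rw [hzi, sub_zero]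
      exact sq_le_sq.2 (by simpa [hτ] using hmin i (Finset.mem_sdiff.1 hi).1)
  have hcard : ((S \ A).card : ℝ) + sparsity z = (A \ S).card + s := by
    have h1 := Finset.card_sdiff_add_card_inter S A
    have h2 := Finset.card_sdiff_add_card_inter A S
    rw [Finset.inter_comm] at h2
    have : (S \ A).card + sparsity z = (A \ S).card + s := by omega
    exact_mod_cast this
  have hk : ((A \ S).card : ℝ) ≤ sparsity z := by
    rw [← hAcard]; exact_mod_cast Finset.card_le_card Finset.sdiff_subset
  have hz' : (sparsity z : ℝ) ≤ s := by exact_mod_cast hz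
  have hs' : (0 : ℝ) < s := by exact_mod_cast hs
  have hratio : ((A \ S).card : ℝ) ≤ (sparsity z : ℝ) / s * (S \ A).card := by
    rw [div_mul_eq_mul_div, le_div_iff₀ hs']
    nlinarith [mul_nonneg (sub_nonneg.2 hk) (sub_nonneg.2 hz')]
  set ρ := Real.sqrt ((sparsity z : ℝ) / s) with hρdef
  have hρsq : ρ ^ 2 = (sparsity z : ℝ) / s := Real.sq_sqrt (by positivity)
  refine le_trans ?_ (mul_le_mul_of_nonneg_left hnorm hρ)
  refine (mul_le_mul_of_nonneg_left hinner zero_le_two).trans ?_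
  refine abs_le_of_sq_le_sq' ?_ (by positivity) |>.2
  set k : ℝ := ((A \ S).card : ℝ)
  set n : ℝ := ((S \ A).card : ℝ)
  have hτ2 := mul_le_mul_of_nonneg_left hcs (mul_nonneg zero_le_four (sq_nonneg τ))
  have h5 : 4 * τ ^ 2 * (k * B) ≤ 4 * τ ^ 2 * (ρ ^ 2 * n * B) := by
    rw [hρsq]
    exact mul_le_mul_of_nonneg_left (mul_le_mul_of_nonneg_right hratio hB0) (by positivity)
  nlinarith [mul_nonneg (sq_nonneg ρ) (sq_nonneg (B - n * τ ^ 2))]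

/-- Restricted eigenvalue boundedness on unit vectors extends to all sparse vectors. -/
theorem sum_sq_le_of_unit_sparse {T M K : ℕ} (hT : 1 ≤ T) {X : Fin T → Fin M → ℝ} {β : ℝ}
    (heig : ∀ v : Fin M → ℝ, ∑ i, v i ^ 2 = 1 → sparsity v ≤ K →
      (1 / (T : ℝ)) * ∑ t, (∑ i, X t i * v i) ^ 2 ≤ β)
    {d : Fin M → ℝ} (hd : sparsity d ≤ K) :
    ∑ t, (∑ i, X t i * d i) ^ 2 ≤ T * β * ∑ i, d i ^ 2 := by
  have hT' : (0 : ℝ) < T := by exact_mod_cast hT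
  set N := ∑ i, d i ^ 2 with hN
  have hN0 : 0 ≤ N := Finset.sum_nonneg fun i _ => sq_nonneg _
  rcases hN0.eq_or_lt with h0 | hpos
  · have hz : ∀ i, d i = 0 := fun i => by
      have := (Finset.sum_eq_zero_iff_of_nonneg fun i _ => sq_nonneg (d i)).1 h0.symm i
        (Finset.mem_univ i)
      simpa using this
    simp [hz, ← h0]
  · have hsq : (Real.sqrt N)⁻¹ ^ 2 = N⁻¹ := by rw [inv_pow, Real.sq_sqrt hN0]
    have h1 := heig (fun i => (Real.sqrt N)⁻¹ * d i)
      (by simp only [mul_pow, ← Finset.mul_sum, hsq, ← hN]; exact inv_mul_cancel₀ hpos.ne')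
      (le_trans (by
        rw [sparsity_eq_card d]
        exact sparsity_le_card fun i hi => by
          have : d i = 0 := by simpa using hi
          rw [this, mul_zero]) hd)
    have h2 : ∑ t, (∑ i, X t i * ((Real.sqrt N)⁻¹ * d i)) ^ 2 =
        N⁻¹ * ∑ t, (∑ i, X t i * d i) ^ 2 := by
      rw [Finset.mul_sum]
      refine Finset.sum_congr rfl fun t _ => ?_
      rw [← hsq, ← mul_pow, Finset.mul_sum]
      congr 1
      exact Finset.sum_congr rfl fun i _ => by ring
    rw [h2, one_div, inv_mul_le_iff₀ hT', inv_mul_le_iff₀ hpos] at h1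
    linarith

/-- Restricted operator bound for the bilinear form `(z, d) ↦ ⟨z, X d⟩ / T`. -/
theorem inner_mul_le_of_unit_sparse {T M K : ℕ} (hT : 1 ≤ T) {X : Fin T → Fin M → ℝ} {β : ℝ}
    (hβ : 0 < β)
    (heig : ∀ v : Fin M → ℝ, ∑ i, v i ^ 2 = 1 → sparsity v ≤ K →
      (1 / (T : ℝ)) * ∑ t, (∑ i, X t i * v i) ^ 2 ≤ β)
    (z : Fin T → ℝ) {d : Fin M → ℝ} (hd : sparsity d ≤ K) :
    (1 / (T : ℝ)) * ∑ t, z t * ∑ i, X t i * d i ≤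
      Real.sqrt (β / T) * Real.sqrt (∑ t, z t ^ 2) * Real.sqrt (∑ i, d i ^ 2) := by
  have hT' : (0 : ℝ) < T := by exact_mod_cast hT
  have h1 := Finset.sum_mul_sq_le_sq_mul_sq Finset.univ z fun t => ∑ i, X t i * d i
  have h2 := sum_sq_le_of_unit_sparse hT heig hd
  have hz : 0 ≤ ∑ t, z t ^ 2 := Finset.sum_nonneg fun i _ => sq_nonneg _
  have hd0 : 0 ≤ ∑ t, d t ^ 2 := Finset.sum_nonneg fun i _ => sq_nonneg _
  refine (abs_le_of_sq_le_sq' ?_ (by positivity)).2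
  rw [mul_pow, mul_pow, mul_pow, Real.sq_sqrt (by positivity), Real.sq_sqrt hz, Real.sq_sqrt hd0]
  calc (1 / (T : ℝ)) ^ 2 * (∑ t, z t * ∑ i, X t i * d i) ^ 2
      ≤ (1 / (T : ℝ)) ^ 2 * ((∑ t, z t ^ 2) * (T * β * ∑ i, d i ^ 2)) :=
        mul_le_mul_of_nonneg_left (h1.trans (mul_le_mul_of_nonneg_left h2 hz)) (by positivity)
    _ = β / T * (∑ t, z t ^ 2) * ∑ i, d i ^ 2 := by field_simp

/-- Hölder bound for the bilinear form `(z, d) ↦ ⟨z, X d⟩ / T` on sparse vectors. -/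
theorem inner_mul_le_iSup_of_sparse {T M K : ℕ} (X : Fin T → Fin M → ℝ)
    (z : Fin T → ℝ) {d : Fin M → ℝ} (hd : sparsity d ≤ K) :
    (1 / (T : ℝ)) * ∑ t, z t * ∑ i, X t i * d i ≤
      Real.sqrt K / T * (⨆ i, |∑ t, X t i * z t|) * Real.sqrt (∑ i, d i ^ 2) := by
  classical
  set m := ⨆ i, |∑ t, X t i * z t| with hm
  have hle : ∀ i, |∑ t, X t i * z t| ≤ m := fun i =>
    le_ciSup (f := fun i => |∑ t, X t i * z t|) (Set.finite_range _).bddAbove i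
  have hm0 : 0 ≤ m := Real.iSup_nonneg fun i => abs_nonneg _
  have hd0 : 0 ≤ ∑ t, d t ^ 2 := Finset.sum_nonneg fun i _ => sq_nonneg _
  have hl1 : ∑ i, |d i| ≤ Real.sqrt K * Real.sqrt (∑ i, d i ^ 2) := by
    rw [← Real.sqrt_mul (Nat.cast_nonneg K)]
    refine Real.le_sqrt_of_sq_le ?_
    rw [← Finset.sum_subset (Finset.subset_univ (Finset.univ.filter fun i => d i ≠ 0))
      (f := fun i => |d i|) fun i _ hi => by simpa using hi]
    refine sq_sum_le_card_mul_sum_sq.trans ?_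
    rw [← sparsity_eq_card]
    refine mul_le_mul (by exact_mod_cast hd) ?_ (Finset.sum_nonneg fun i _ => sq_nonneg _)
      (Nat.cast_nonneg K)
    simp only [sq_abs]
    exact Finset.sum_le_sum_of_subset_of_nonneg (Finset.subset_univ _) fun i _ _ => sq_nonneg _
  have hswap : ∑ t, z t * ∑ i, X t i * d i = ∑ i, (∑ t, X t i * z t) * d i := by
    simp only [Finset.mul_sum, Finset.sum_mul]
    rw [Finset.sum_comm]
    exact Finset.sum_congr rfl fun i _ => Finset.sum_congr rfl fun t _ => by ring
  have hmain : ∑ t, z t * ∑ i, X t i * d i ≤ m * (Real.sqrt K * Real.sqrt (∑ i, d i ^ 2)) := by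
    rw [hswap]
    refine le_trans ?_ (mul_le_mul_of_nonneg_left hl1 hm0)
    rw [Finset.mul_sum]
    refine Finset.sum_le_sum fun i _ => (le_abs_self _).trans ?_
    rw [abs_mul]
    exact mul_le_mul_of_nonneg_right (hle i) (abs_nonneg _)
  refine (mul_le_mul_of_nonneg_left hmain (by positivity)).trans_eq ?_
  ring

/-- Normalizing a vector of norm at least one does not move it away from a unit vector. -/
theorem sum_normalize_sub_sq_le {M : ℕ} {a b : Fin M → ℝ} (ha : 1 ≤ ∑ i, a i ^ 2)
    (hb : ∑ i, b i ^ 2 = 1) :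
    ∑ i, (a i / Real.sqrt (∑ k, a k ^ 2) - b i) ^ 2 ≤ ∑ i, (a i - b i) ^ 2 := by
  set n := Real.sqrt (∑ k, a k ^ 2) with hn
  have hn1 : 1 ≤ n := Real.one_le_sqrt.2 ha
  have hn0 : 0 < n := by linarith
  have hnsq : n ^ 2 = ∑ k, a k ^ 2 := Real.sq_sqrt (by linarith)
  have hcs := Finset.sum_mul_sq_le_sq_mul_sq Finset.univ a b
  rw [hb, mul_one, ← hnsq] at hcs
  have hp := (abs_le_of_sq_le_sq' hcs hn0.le).2
  set p := ∑ i, a i * b i with hp'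
  have e1 : ∑ i, (a i / n - b i) ^ 2 = n⁻¹ ^ 2 * ∑ i, a i ^ 2 - 2 * n⁻¹ * p + ∑ i, b i ^ 2 := by
    simp only [hp', Finset.mul_sum, ← Finset.sum_sub_distrib, ← Finset.sum_add_distrib]
    exact Finset.sum_congr rfl fun i _ => by ring
  have e2 : ∑ i, (a i - b i) ^ 2 = ∑ i, a i ^ 2 - 2 * p + ∑ i, b i ^ 2 := by
    simp only [hp', Finset.mul_sum, ← Finset.sum_sub_distrib, ← Finset.sum_add_distrib]
    exact Finset.sum_congr rfl fun i _ => by ring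
  rw [e1, e2, ← hnsq, hb, ← mul_pow, inv_mul_cancel₀ hn0.ne']
  have hinv : n⁻¹ ≤ 1 := inv_le_one_of_one_le₀ hn1
  have h3 : p * (1 - n⁻¹) ≤ n * (1 - n⁻¹) := mul_le_mul_of_nonneg_right hp (by linarith)
  have h4 : n * (1 - n⁻¹) = n - 1 := by field_simp
  nlinarith [sq_nonneg (n - 1)]

/-- Projecting onto the orthogonal complement of a unit vector does not increase the norm. -/
theorem sum_orthogonal_sq_le {M : ℕ} {u : Fin M → ℝ} (hu : ∑ i, u i ^ 2 = 1)
    (d : Fin M → ℝ) :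
    ∑ i, (d i - (∑ k, u k * d k) * u i) ^ 2 ≤ ∑ i, d i ^ 2 := by
  set c := ∑ k, u k * d k with hc
  have e : ∑ i, (d i - c * u i) ^ 2 = ∑ i, d i ^ 2 - 2 * c * ∑ k, u k * d k
      + c ^ 2 * ∑ i, u i ^ 2 := by
    simp only [Finset.mul_sum, ← Finset.sum_sub_distrib, ← Finset.sum_add_distrib]
    exact Finset.sum_congr rfl fun i _ => by ring
  rw [e, hu, ← hc]
  nlinarith [sq_nonneg c]

/-- Combination of the per-step estimates by two applications of Young's inequality. -/
theorem contraction_of_step_bounds {L β α δ ε ρ A D E R C G : ℝ} (hL : 0 < L) (hβ : 0 < β)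
    (hα : 0 < α) (hδ : 0 < δ) (hA : 0 ≤ A) (hE : 0 ≤ E) (hR : 0 ≤ R)
    (hstep : A + E - D - 2 * (1 / (L * β)) * G ≤ ρ * A)
    (hG : G ≤ C * Real.sqrt A + Real.sqrt (β * R) * Real.sqrt E - R / L)
    (hid : α * D - ε ^ 2 ≤ R) :
    (1 - ρ - α * δ / (L ^ 2 * β)) * A ≤
      (1 - α / (L ^ 2 * β)) * D + ε ^ 2 / (L ^ 2 * β) + C ^ 2 / (δ * α * β) := by
  have hLβ : 0 < L * β := mul_pos hL hβ
  have young1 : 2 * (1 / (L * β)) * (C * Real.sqrt A) ≤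
      C ^ 2 / (δ * α * β) + α * δ / (L ^ 2 * β) * A := by
    have h := sq_nonneg (C * L - α * δ * Real.sqrt A)
    have hs := Real.sq_sqrt hA
    have e : C ^ 2 / (δ * α * β) + α * δ / (L ^ 2 * β) * A - 2 * (1 / (L * β)) * (C * Real.sqrt A)
        = (C * L - α * δ * Real.sqrt A) ^ 2 / (δ * α * β * L ^ 2) := by
      nth_rw 1 [← hs]
      field_simp
      ring
    have : 0 ≤ (C * L - α * δ * Real.sqrt A) ^ 2 / (δ * α * β * L ^ 2) := by positivity
    linarith
  have young2 : 2 * (1 / (L * β)) * (Real.sqrt (β * R) * Real.sqrt E) ≤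
      E + R / (L ^ 2 * β) := by
    have hs := Real.sq_sqrt hE
    have hr := Real.sq_sqrt (mul_nonneg hβ.le hR)
    have h := sq_nonneg (Real.sqrt E - Real.sqrt (β * R) / (L * β))
    have e : (Real.sqrt (β * R) / (L * β)) ^ 2 = R / (L ^ 2 * β) := by
      rw [div_pow, hr]; field_simp
    have e2 : 2 * (1 / (L * β)) * (Real.sqrt (β * R) * Real.sqrt E) =
        2 * Real.sqrt E * (Real.sqrt (β * R) / (L * β)) := by ring
    rw [e2]
    nlinarith
  have hG' := mul_le_mul_of_nonneg_left hG (by positivity : 0 ≤ 2 * (1 / (L * β)))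
  have e3 : 2 * (1 / (L * β)) * (R / L) = 2 * (R / (L ^ 2 * β)) := by field_simp
  have hid' : α / (L ^ 2 * β) * D - ε ^ 2 / (L ^ 2 * β) ≤ R / (L ^ 2 * β) := by
    have := div_le_div_of_nonneg_right hid (by positivity : 0 ≤ L ^ 2 * β)
    refine le_trans (le_of_eq ?_) this
    ring
  nlinarith

/-- (Lemma: iterative guarantee)  One step of the alternating projected gradient descent
algorithm with step size η_j = 1/(L_jβ) satisfies, for every δ_j > 0,
(1 − √(s_j*/s_j) − α_jδ_j/(L_j²β))·‖u_j^(k) − u_j*‖₂² ≤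
(1 − α_j/(L_j²β))·‖u_j^(k−1) − u_j*‖₂² + ε_j²/(L_j²β) + C(Z_j, u_j^(k−1))²/(δ_jα_jβ). -/
theorem iterative_guarantee {T M : ℕ} (hT : 1 ≤ T)
    (X : Fin T → Fin M → ℝ) (y : Fin T → ℝ)
    (f : ℝ → ℝ) (hfmono : Monotone f)
    (L : ℝ) (hL : 0 < L) (hflip : ∀ a b : ℝ, |f a - f b| ≤ L * |a - b|)
    (ustar : Fin M → ℝ) (sstar s : ℕ)
    (hunorm : ∑ i, ustar i ^ 2 = 1) (husparse : sparsity ustar = sstar)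
    (β : ℝ) (hβ : 0 < β)
    (heig : ∀ v : Fin M → ℝ, ∑ i, v i ^ 2 = 1 → sparsity v ≤ 2 * s + sstar →
      (1 / (T : ℝ)) * ∑ t, (∑ i, X t i * v i) ^ 2 ≤ β)
    (α ε : ℝ) (hα : 0 < α) (hε : 0 ≤ ε)
    (hident : ∀ g : ℝ → ℝ, Monotone g → ∀ v : Fin M → ℝ,
      ∑ i, v i ^ 2 = 1 → sparsity v ≤ s →
      α * (∑ i, (v i - ustar i) ^ 2) - ε ^ 2 ≤
        (1 / (T : ℝ)) * ∑ t, (g (∑ i, X t i * v i) - f (∑ i, X t i * ustar i)) ^ 2)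
    -- the current iterate
    (uprev : Fin M → ℝ)
    (huprev_norm : ∑ i, uprev i ^ 2 = 1) (huprev_sparse : sparsity uprev ≤ s)
    (hacute : 0 ≤ ∑ i, uprev i * ustar i)
    -- the isotonic regressions at the current iterate
    (g1 g2 : Fin T → ℝ)
    (hg1 : IsIsoProj (fun t => ∑ i, X t i * uprev i) y g1)
    (hg2 : IsIsoProj (fun t => ∑ i, X t i * uprev i)
      (fun t => f (∑ i, X t i * ustar i)) g2)
    -- one step of the algorithm: orthogonal pseudo-gradient, hard threshold, normalize
    (w utilde phi unext : Fin M → ℝ)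
    (hw : ∀ i, w i = (1 / (T : ℝ)) * ∑ t, X t i * (y t - g1 t))
    (hutilde : ∀ i, utilde i = uprev i +
      (1 / (L * β)) * (w i - (∑ i', uprev i' * w i') * uprev i))
    (hphi : IsHardThresh s utilde phi)
    (hunext : ∀ i, unext i = phi i / Real.sqrt (∑ i', phi i' ^ 2))
    (δ : ℝ) (hδ : 0 < δ) :
    (1 - Real.sqrt ((sstar : ℝ) / (s : ℝ)) - α * δ / (L ^ 2 * β)) *
        ∑ i, (unext i - ustar i) ^ 2 ≤
      (1 - α / (L ^ 2 * β)) * ∑ i, (uprev i - ustar i) ^ 2 + ε ^ 2 / (L ^ 2 * β) +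
        (Real.sqrt ((2 * s + sstar : ℕ) : ℝ) / (T : ℝ) *
            (⨆ i, |∑ t, X t i * (y t - f (∑ i', X t i' * ustar i'))|) +
          Real.sqrt (β / (T : ℝ)) * Real.sqrt (∑ t, (g2 t - g1 t) ^ 2)) ^ 2 /
          (δ * α * β) := by
  classical
  have hT' : (0 : ℝ) < T := by exact_mod_cast hT
  have hs : 0 < s := by
    refine lt_of_lt_of_le (Nat.pos_of_ne_zero fun h0 => ?_) huprev_sparse
    rw [sparsity_eq_card, Finset.card_eq_zero, Finset.filter_eq_empty_iff] at h0
    have hz : ∀ i, uprev i = 0 := fun i => not_not.1 (h0 (Finset.mem_univ i))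
    simp [hz] at huprev_norm
  have hs' : (0 : ℝ) < s := by exact_mod_cast hs
  have hcont : Continuous f :=
    (LipschitzWith.of_dist_le_mul (K := ⟨L, hL.le⟩) fun a b => hflip a b).continuous
  set ρ := Real.sqrt ((sstar : ℝ) / (s : ℝ)) with hρ
  set C := Real.sqrt ((2 * s + sstar : ℕ) : ℝ) / (T : ℝ) *
            (⨆ i, |∑ t, X t i * (y t - f (∑ i', X t i' * ustar i'))|) +
          Real.sqrt (β / (T : ℝ)) * Real.sqrt (∑ t, (g2 t - g1 t) ^ 2) with hC
  have hsup : 0 ≤ ⨆ i, |∑ t, X t i * (y t - f (∑ i', X t i' * ustar i'))| :=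
    Real.iSup_nonneg fun i => abs_nonneg _
  have hC0 : 0 ≤ C := by positivity
  set D := ∑ i, (uprev i - ustar i) ^ 2 with hD
  by_cases hcoef : 1 - ρ - α * δ / (L ^ 2 * β) ≤ 0
  · refine (mul_nonpos_of_nonpos_of_nonneg hcoef
      (Finset.sum_nonneg fun i _ => sq_nonneg _)).trans ?_
    have h1 := hident f hfmono uprev huprev_norm huprev_sparse
    have hsp : sparsity (fun i => uprev i - ustar i) ≤ 2 * s + sstar := by
      have := sparsity_le_add_add (u := fun i => uprev i - ustar i) (a := uprev) (b := uprev)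
        (c := ustar) fun i ha _ hc => by simp [ha, hc]
      omega
    have h2 := sum_sq_le_of_unit_sparse hT heig hsp
    have h3 : ∑ t, (f (∑ i, X t i * uprev i) - f (∑ i, X t i * ustar i)) ^ 2 ≤
        L ^ 2 * ∑ t, (∑ i, X t i * (uprev i - ustar i)) ^ 2 := by
      rw [Finset.mul_sum]
      refine Finset.sum_le_sum fun t _ => ?_
      have := hflip (∑ i, X t i * uprev i) (∑ i, X t i * ustar i)
      simp only [mul_sub, Finset.sum_sub_distrib]
      rw [← mul_pow]
      refine sq_le_sq.2 (this.trans_eq ?_)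
      rw [abs_mul, abs_of_pos hL]
    have h4 : (1 / (T : ℝ)) * ∑ t, (f (∑ i, X t i * uprev i) - f (∑ i, X t i * ustar i)) ^ 2 ≤
        L ^ 2 * β * D := by
      rw [one_div, inv_mul_le_iff₀ hT']
      refine h3.trans ((mul_le_mul_of_nonneg_left h2 (sq_nonneg L)).trans_eq ?_)
      ring
    have h5 := div_nonneg (sub_nonneg.2 (h1.trans h4)) (by positivity : 0 ≤ L ^ 2 * β)
    have h6 : 0 ≤ C ^ 2 / (δ * α * β) := by positivity
    have h7 : (L ^ 2 * β * D - (α * D - ε ^ 2)) / (L ^ 2 * β) =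
        (1 - α / (L ^ 2 * β)) * D + ε ^ 2 / (L ^ 2 * β) := by
      field_simp
      ring
    rw [hD] at h5 h7 ⊢
    linarith
  push Not at hcoef
  have hss : sparsity ustar ≤ s := by
    have h1 : ρ < 1 := by
      have : 0 ≤ α * δ / (L ^ 2 * β) := by positivity
      linarith
    rw [hρ, Real.sqrt_lt' one_pos, one_pow, div_lt_one hs'] at h1
    rw [husparse]
    exact_mod_cast h1.le
  have hht := hphi.two_mul_sum_le hs hss
  rw [husparse, ← hρ] at hht
  set η := 1 / (L * β) with hη
  set A := ∑ i, (phi i - ustar i) ^ 2 with hA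
  set E := ∑ i, (phi i - uprev i) ^ 2 with hE
  have hA0 : 0 ≤ A := Finset.sum_nonneg fun i _ => sq_nonneg _
  have hE0 : 0 ≤ E := Finset.sum_nonneg fun i _ => sq_nonneg _
  set R := (1 / (T : ℝ)) * ∑ t, (f (∑ i, X t i * ustar i) - g2 t) ^ 2 with hR
  have hR0 : 0 ≤ R := mul_nonneg (by positivity) (Finset.sum_nonneg fun i _ => sq_nonneg _)
  set c := ∑ i, uprev i * w i with hc
  -- the thresholded vector has norm at least one
  have hphi1 : 1 ≤ ∑ i, phi i ^ 2 := by
    have h1 := hphi.2 uprev huprev_sparse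
    have h2 : ∑ i, (phi i - utilde i) ^ 2 = ∑ i, utilde i ^ 2 - ∑ i, phi i ^ 2 := by
      rw [← Finset.sum_sub_distrib]
      refine Finset.sum_congr rfl fun i _ => ?_
      by_cases h0 : phi i = 0
      · rw [h0]; ring
      · rw [hphi.apply_eq_of_ne_zero h0]; ring
    have h3 : ∑ i, (uprev i - utilde i) ^ 2 =
        ∑ i, utilde i ^ 2 - ∑ i, uprev i ^ 2
          - (2 * η * ∑ i, uprev i * w i - 2 * η * c * ∑ i, uprev i ^ 2) := by
      simp only [Finset.mul_sum, ← Finset.sum_sub_distrib]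
      refine Finset.sum_congr rfl fun i _ => ?_
      rw [hutilde i]
      ring
    rw [h2, h3, huprev_norm, ← hc] at h1
    linarith
  have hfin : ∑ i, (unext i - ustar i) ^ 2 ≤ A := by
    simp only [hunext]
    exact sum_normalize_sub_sq_le hphi1 hunorm
  refine (mul_le_mul_of_nonneg_left hfin hcoef.le).trans ?_
  obtain ⟨g, hgmono, hg⟩ := exists_monotone_comp_eq hg2.1
  have hid : α * D - ε ^ 2 ≤ R := by
    refine (hident g hgmono uprev huprev_norm huprev_sparse).trans_eq ?_
    rw [hR]
    congr 1
    refine Finset.sum_congr rfl fun t _ => ?_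
    rw [hg t]
    ring
  set r : Fin T → ℝ := fun t => f (∑ i, X t i * ustar i) with hr
  set a := ∑ i, uprev i * (phi i - ustar i) with ha
  set q : Fin M → ℝ := fun i => (phi i - ustar i) - a * uprev i with hq
  set b := ∑ i, uprev i * (phi i - uprev i) with hb
  set q' : Fin M → ℝ := fun i => (phi i - uprev i) - b * uprev i with hq'
  set o := ∑ i, uprev i * ustar i with ho
  set G := ∑ i, (phi i - ustar i) * (w i - c * uprev i) with hG
  have hstep : A + E - D - 2 * η * G ≤ ρ * A := by
    refine le_trans (le_of_eq ?_) hht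
    simp only [hA, hE, hD, hG, Finset.mul_sum, ← Finset.sum_sub_distrib,
      ← Finset.sum_add_distrib]
    refine Finset.sum_congr rfl fun i _ => ?_
    rw [hutilde i]
    ring
  refine contraction_of_step_bounds hL hβ hα hδ hA0 hE0 hR0 hstep ?_ hid
  have hqs : sparsity q ≤ 2 * s + sstar := by
    have := sparsity_le_add_add (u := q) (a := phi) (b := uprev) (c := ustar)
      fun i h1 h2 h3 => by simp [hq, h1, h2, h3]
    have := hphi.1
    omega
  have hqs' : sparsity q' ≤ 2 * s + sstar := by
    have := sparsity_le_add_add (u := q') (a := phi) (b := uprev) (c := ustar)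
      fun i h1 h2 h3 => by simp [hq', h1, h2]
    have := hphi.1
    omega
  have hqA : ∑ i, q i ^ 2 ≤ A := sum_orthogonal_sq_le huprev_norm fun i => phi i - ustar i
  have hqE : ∑ i, q' i ^ 2 ≤ E := sum_orthogonal_sq_le huprev_norm fun i => phi i - uprev i
  -- the gradient term as a bilinear form
  have hGq : G = (1 / (T : ℝ)) * ∑ t, (y t - g1 t) * ∑ i, X t i * q i := by
    have h1 : G = ∑ i, w i * q i := by
      have e1 : G = ∑ i, w i * (phi i - ustar i) - c * a := by
        simp only [hG, ha, Finset.mul_sum, ← Finset.sum_sub_distrib]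
        exact Finset.sum_congr rfl fun i _ => by ring
      have e2 : ∑ i, w i * q i = ∑ i, w i * (phi i - ustar i) - a * c := by
        rw [hc, Finset.mul_sum, ← Finset.sum_sub_distrib]
        exact Finset.sum_congr rfl fun i _ => by simp only [hq]; ring
      rw [e1, e2]; ring
    rw [h1]
    simp only [hw, Finset.mul_sum, Finset.sum_mul]
    rw [Finset.sum_comm]
    exact Finset.sum_congr rfl fun i _ => Finset.sum_congr rfl fun t _ => by ring
  have hsplit : G = (1 / (T : ℝ)) * (∑ t, (y t - r t) * ∑ i, X t i * q i)
      + (1 / (T : ℝ)) * (∑ t, (g2 t - g1 t) * ∑ i, X t i * q i)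
      + (1 / (T : ℝ)) * (∑ t, (r t - g2 t) * ∑ i, X t i * q i) := by
    rw [hGq, ← mul_add, ← mul_add, ← Finset.sum_add_distrib, ← Finset.sum_add_distrib]
    congr 1
    exact Finset.sum_congr rfl fun t _ => by ring
  have hXq : ∀ t, ∑ i, X t i * q i = ∑ i, X t i * q' i - ∑ i, X t i * ustar i
      + o * ∑ i, X t i * uprev i := by
    intro t
    have hab : a = b + 1 - o := by
      rw [← huprev_norm]
      simp only [ha, hb, ho, ← Finset.sum_sub_distrib, ← Finset.sum_add_distrib]
      exact Finset.sum_congr rfl fun i _ => by ring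
    rw [Finset.mul_sum _ _ o, ← Finset.sum_sub_distrib, ← Finset.sum_add_distrib]
    exact Finset.sum_congr rfl fun i _ => by simp only [hq, hq', hab]; ring
  have hlast : (1 / (T : ℝ)) * (∑ t, (r t - g2 t) * ∑ i, X t i * q i) =
      (1 / (T : ℝ)) * (∑ t, (r t - g2 t) * ∑ i, X t i * q' i)
      - (1 / (T : ℝ)) * (∑ t, (r t - g2 t) * ∑ i, X t i * ustar i)
      + (1 / (T : ℝ)) * (o * ∑ t, (r t - g2 t) * ∑ i, X t i * uprev i) := by
    rw [Finset.mul_sum _ _ o, ← mul_sub, ← mul_add, ← Finset.sum_sub_distrib,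
      ← Finset.sum_add_distrib]
    congr 1
    exact Finset.sum_congr rfl fun t _ => by rw [hXq]; ring
  have hco := hg2.sum_sq_le hcont hfmono hflip
  have hco' : R / L ≤ (1 / (T : ℝ)) * (∑ t, (r t - g2 t) * ∑ i, X t i * ustar i) := by
    rw [div_le_iff₀ hL, hR, mul_assoc, mul_comm _ L]
    exact mul_le_mul_of_nonneg_left hco (by positivity)
  have hneg : (1 / (T : ℝ)) * (o * ∑ t, (r t - g2 t) * ∑ i, X t i * uprev i) ≤ 0 :=
    mul_nonpos_of_nonneg_of_nonpos (by positivity)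
      (mul_nonpos_of_nonneg_of_nonpos hacute hg2.sum_mul_self_nonpos)
  have hb1 := inner_mul_le_iSup_of_sparse X (fun t => y t - r t) hqs
  have hb2 := inner_mul_le_of_unit_sparse hT hβ heig (fun t => g2 t - g1 t) hqs
  have hb3 := inner_mul_le_of_unit_sparse hT hβ heig (fun t => r t - g2 t) hqs'
  have hbR : Real.sqrt (β / T) * Real.sqrt (∑ t, (r t - g2 t) ^ 2) = Real.sqrt (β * R) := by
    rw [← Real.sqrt_mul (by positivity), hR]
    congr 1
    ring
  have hb12 : Real.sqrt ((2 * s + sstar : ℕ) : ℝ) / (T : ℝ) *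
            (⨆ i, |∑ t, X t i * (y t - r t)|) * Real.sqrt (∑ i, q i ^ 2) +
          Real.sqrt (β / (T : ℝ)) * Real.sqrt (∑ t, (g2 t - g1 t) ^ 2)
            * Real.sqrt (∑ i, q i ^ 2) ≤ C * Real.sqrt A := by
    rw [← add_mul]
    exact mul_le_mul_of_nonneg_left (Real.sqrt_le_sqrt hqA) hC0
  have hb3' := mul_le_mul_of_nonneg_left (Real.sqrt_le_sqrt hqE) (Real.sqrt_nonneg (β * R))
  rw [hbR] at hb3
  linarith
end
end

section
/- (Range bound for the isotonic projection of the observations) Let X_{−T} ∈ ℝ^{T×M} have all entries bounded in absolute value by M_x, let u_j* ∈ ℝ^M be a unit vector with at most s_j* nonzero entries, let f_j* : ℝ → ℝ be nondecreasing and L_j-Lipschitz, let X_{−0,j} ∈ ℝ^T, and set Z_j = X_{−0,j} − f_j*(X_{−T}u_j*) (entrywise). Then for every v ∈ ℝ^T, max_i (iso_v(X_{−0,j}))_i − min_i (iso_v(X_{−0,j}))_i ≤ 2·‖Z_j‖_∞ + 2·L_j·M_x·√(s_j*). -/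
open MeasureTheory

noncomputable section

/-- Isotonic regression preserves interval bounds. -/
theorem IsIsoProj.mem_Icc {T : ℕ} {v w x : Fin T → ℝ} (h : IsIsoProj v w x) {a b : ℝ}
    (hw : ∀ t, w t ∈ Set.Icc a b) (t : Fin T) : x t ∈ Set.Icc a b := by
  by_contra hx
  refine (h.2 (fun r => max a (min (x r) b)) fun i j hij =>
    max_le_max_left a (min_le_min_right b (h.1 i j hij))).not_gt ?_
  refine Finset.sum_lt_sum (fun r _ => ?_) ⟨t, Finset.mem_univ t, ?_⟩
  · obtain ⟨h₁, h₂⟩ := hw r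
    rcases le_total (x r) b with h₃ | h₃ <;> rcases le_total a (x r) with h₄ | h₄ <;>
      simp [h₃, h₄, h₁.trans h₂] <;> nlinarith
  · obtain ⟨h₁, h₂⟩ := hw t
    rcases le_or_gt (x t) b with h₃ | h₃
    · have h₄ : x t < a := not_le.mp fun h₄ => hx ⟨h₄, h₃⟩
      simp only [min_eq_left h₃, max_eq_left h₄.le]
      nlinarith
    · simp only [min_eq_right h₃.le, max_eq_right (h₁.trans h₂)]
      nlinarith

/-- The `ℓ₁` norm of a unit vector is at most the square root of its sparsity. -/
theorem sum_abs_le_sqrt_sparsity {M : ℕ} (u : Fin M → ℝ) (hu : ∑ i, u i ^ 2 = 1) :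
    ∑ i, |u i| ≤ Real.sqrt (sparsity u) := by
  classical
  have hcard : sparsity u = (Finset.univ.filter fun i => u i ≠ 0).card := by
    rw [sparsity, ← Set.ncard_coe_finset]
    simp
  have hsum : ∑ i with u i ≠ 0, |u i| = ∑ i, |u i| :=
    Finset.sum_filter_of_ne fun i _ hi => abs_ne_zero.mp hi
  apply Real.le_sqrt_of_sq_le
  rw [← hsum, hcard]
  calc (∑ i with u i ≠ 0, |u i|) ^ 2
      ≤ (Finset.univ.filter fun i => u i ≠ 0).card * ∑ i with u i ≠ 0, |u i| ^ 2 :=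
        sq_sum_le_card_mul_sum_sq
    _ ≤ (Finset.univ.filter fun i => u i ≠ 0).card * 1 := by
        gcongr
        simp only [sq_abs, ← hu]
        exact Finset.sum_le_univ_sum_of_nonneg fun i => sq_nonneg (u i)
    _ = _ := mul_one _

/-- (Range bound for the isotonic projection of the observations)
If all entries of X_{−T} are bounded by M_x, u_j* is a unit vector with at most s_j*
nonzero entries, f_j* is nondecreasing and L_j-Lipschitz, and
Z_j = X_{−0,j} − f_j*(X_{−T}u_j*), then for every reference vector v the range of
iso_v(X_{−0,j}) is at most 2‖Z_j‖_∞ + 2·L_j·M_x·√(s_j*). -/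
theorem iso_observation_range {T M : ℕ} (X : Fin T → Fin M → ℝ) (Mx : ℝ)
    (hX : ∀ t i, |X t i| ≤ Mx)
    (ustar : Fin M → ℝ) (sstar : ℕ)
    (hunorm : ∑ i, ustar i ^ 2 = 1) (husparse : sparsity ustar ≤ sstar)
    (f : ℝ → ℝ) (L : ℝ) (hfmono : Monotone f)
    (hflip : ∀ a b : ℝ, |f a - f b| ≤ L * |a - b|)
    (y : Fin T → ℝ)
    (v g : Fin T → ℝ)
    (hg : IsIsoProj v y g) :
    ∀ t t', g t - g t' ≤
      2 * (⨆ r, |y r - f (∑ i, X r i * ustar i)|) + 2 * L * Mx * Real.sqrt (sstar : ℝ) := by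
  intro t t'
  have hL : 0 ≤ L := by
    have := (abs_nonneg _).trans (hflip 1 0)
    simpa using this
  have hMx : 0 ≤ Mx := by
    have : Nonempty (Fin M) := by
      by_contra hM
      rw [not_nonempty_iff] at hM
      simp at hunorm
    exact (abs_nonneg _).trans (hX t this.some)
  have hu : ∑ i, |ustar i| ≤ Real.sqrt sstar :=
    (sum_abs_le_sqrt_sparsity ustar hunorm).trans
      (Real.sqrt_le_sqrt (Nat.cast_le.mpr husparse))
  have hXu (r : Fin T) : |∑ i, X r i * ustar i| ≤ Mx * Real.sqrt sstar := by
    calc |∑ i, X r i * ustar i| ≤ ∑ i, |X r i * ustar i| := Finset.abs_sum_le_sum_abs _ _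
      _ ≤ ∑ i, Mx * |ustar i| := by
          gcongr with i
          rw [abs_mul]
          gcongr
          exact hX r i
      _ = Mx * ∑ i, |ustar i| := by rw [Finset.mul_sum]
      _ ≤ Mx * Real.sqrt sstar := by gcongr
  set Z := ⨆ r, |y r - f (∑ i, X r i * ustar i)| with hZ
  have hy (r : Fin T) : y r ∈ Set.Icc (f 0 - (Z + L * (Mx * Real.sqrt sstar)))
      (f 0 + (Z + L * (Mx * Real.sqrt sstar))) := by
    have h₁ : |y r - f (∑ i, X r i * ustar i)| ≤ Z :=
      le_ciSup (f := fun r => |y r - f (∑ i, X r i * ustar i)|) (Set.finite_range _).bddAbove r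
    have h₂ : |f (∑ i, X r i * ustar i) - f 0| ≤ L * (Mx * Real.sqrt sstar) := by
      refine (hflip _ _).trans ?_
      rw [sub_zero]
      gcongr
      exact hXu r
    rw [abs_le] at h₁ h₂
    constructor <;> linarith
  have h₁ := (hg.mem_Icc hy t).2
  have h₂ := (hg.mem_Icc hy t').1
  linarith
end
end

section
/- (Variance lower bound for the signal under identifiability) Fix j and suppose the identifiability condition holds with s_j ≥ s_j*: (1/T)‖f_j(X_{−T}u_j) − f_j*(X_{−T}u_j*)‖₂² ≥ α_j‖u_j − u_j*‖₂² − ε_j² for every nondecreasing f_j : ℝ → ℝ and every unit vector u_j with at most s_j nonzero entries, where u_j* is a unit vector with at most s_j* nonzero entries and f_j* is nondecreasing. Then (1/T)·‖f_j*(X_{−T}u_j*) − m·1_T‖₂² ≥ 4α_j − ε_j², where m is the mean of the entries of f_j*(X_{−T}u_j*) and 1_T is the all-ones vector in ℝ^T. -/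
open MeasureTheory

noncomputable section

/-- (Variance lower bound for the signal under identifiability)
If the identifiability condition holds with s_j ≥ s_j*, then the empirical variance of
the signal f_j*(X_{−T}u_j*) is at least 4α_j − ε_j². -/
theorem signal_variance_lower {T M : ℕ} (X : Fin T → Fin M → ℝ)
    (ustar : Fin M → ℝ) (sstar s : ℕ) (hss : sstar ≤ s)
    (hunorm : ∑ i, ustar i ^ 2 = 1) (husparse : sparsity ustar ≤ sstar)
    (f : ℝ → ℝ) (hfmono : Monotone f)
    (α ε : ℝ) (hα : 0 < α) (hε : 0 ≤ ε)
    (hident : ∀ g : ℝ → ℝ, Monotone g → ∀ u : Fin M → ℝ,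
      ∑ i, u i ^ 2 = 1 → sparsity u ≤ s →
      α * (∑ i, (u i - ustar i) ^ 2) - ε ^ 2 ≤
        (1 / (T : ℝ)) * ∑ t, (g (∑ i, X t i * u i) - f (∑ i, X t i * ustar i)) ^ 2) :
    4 * α - ε ^ 2 ≤
      (1 / (T : ℝ)) * ∑ t, (f (∑ i, X t i * ustar i) -
        (1 / (T : ℝ)) * ∑ r, f (∑ i, X r i * ustar i)) ^ 2 := by
  have h := hident (fun _ => (1 / (T : ℝ)) * ∑ r, f (∑ i, X r i * ustar i)) monotone_const
    (fun i => -ustar i) (by simpa using hunorm) (by simpa [sparsity] using husparse.trans hss)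
  have hdist : ∑ i, (-ustar i - ustar i) ^ 2 = 4 := by
    calc ∑ i, (-ustar i - ustar i) ^ 2 = 4 * ∑ i, ustar i ^ 2 := by
          rw [Finset.mul_sum]
          exact Finset.sum_congr rfl fun i _ => by ring
      _ = 4 := by rw [hunorm, mul_one]
  rw [hdist, mul_comm α] at h
  simpa only [sub_sq_comm] using h
end
end

section
/- (Lipschitz lower bound for the isotonic residual, Lemma 6 of Dai et al.) Let X ∈ ℝ^{T×M}, let u*, u ∈ ℝ^M, and let f* : ℝ → ℝ be nondecreasing and L-Lipschitz. Then ⟨Xu*, f*(Xu*) − iso_{Xu}(f*(Xu*))⟩ ≥ L^{−1}·‖f*(Xu*) − iso_{Xu}(f*(Xu*))‖₂², where f* is applied entrywise to Xu*. -/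
open MeasureTheory

noncomputable section

/-- A monotone Lipschitz function is cocoercive. -/
theorem inv_mul_sq_sub_le_of_monotone_lipschitz {f : ℝ → ℝ} {L : ℝ} (hf : Monotone f)
    (hL : ∀ a b : ℝ, |f a - f b| ≤ L * |a - b|) (a b : ℝ) :
    L⁻¹ * (f a - f b) ^ 2 ≤ (a - b) * (f a - f b) := by
  have hL0 : 0 ≤ L := by simpa using (abs_nonneg _).trans (hL 1 0)
  have habs : (a - b) * (f a - f b) = |a - b| * |f a - f b| := by
    rw [← abs_mul, abs_of_nonneg]
    rcases le_total a b with h | h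
    · exact mul_nonneg_of_nonpos_of_nonpos (sub_nonpos.2 h) (sub_nonpos.2 (hf h))
    · exact mul_nonneg (sub_nonneg.2 h) (sub_nonneg.2 (hf h))
  rw [habs]
  rcases hL0.eq_or_lt with rfl | hpos
  · simpa using mul_nonneg (abs_nonneg (a - b)) (abs_nonneg (f a - f b))
  · rw [inv_mul_le_iff₀ hpos, ← sq_abs, sq, ← mul_assoc]
    exact mul_le_mul_of_nonneg_right (hL a b) (abs_nonneg _)

/-- The residual of an isotonic regression is orthogonal to every vector that is constant on the
level sets of the fit. -/
theorem IsIsoProj.sum_comp_mul_residual_eq_zero {T : ℕ} {v w g : Fin T → ℝ}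
    (hg : IsIsoProj v w g) (h : ℝ → ℝ) : ∑ t, h (g t) * (w t - g t) = 0 := by
  have hcone : ∀ᶠ ε : ℝ in nhds 0, ∀ i j, v i ≤ v j →
      g i + ε * h (g i) ≤ g j + ε * h (g j) := by
    refine Filter.eventually_all.2 fun i => Filter.eventually_all.2 fun j => ?_
    by_cases hv : v i ≤ v j
    · rcases (hg.1 i j hv).eq_or_lt with heq | hlt
      · exact Filter.Eventually.of_forall fun ε _ => by rw [heq]
      · have hi : ContinuousAt (fun ε : ℝ => g i + ε * h (g i)) 0 := by fun_prop
        have hj : ContinuousAt (fun ε : ℝ => g j + ε * h (g j)) 0 := by fun_prop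
        filter_upwards [hi.eventually_lt hj (by simpa using hlt)] with ε hε _ using hε.le
    · exact Filter.Eventually.of_forall fun ε hv' => absurd hv' hv
  have hmin : IsLocalMin (fun ε : ℝ => ∑ t, (w t - (g t + ε * h (g t))) ^ 2) 0 := by
    filter_upwards [hcone] with ε hε
    simpa using hg.2 _ hε
  have hderiv : HasDerivAt (fun ε : ℝ => ∑ t, (w t - (g t + ε * h (g t))) ^ 2)
      (∑ t, -2 * (h (g t) * (w t - g t))) 0 := by
    refine HasDerivAt.fun_sum fun t _ => ?_
    have hd := ((((hasDerivAt_id' (0 : ℝ)).mul_const (h (g t))).const_add (g t)).const_sub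
      (w t)).fun_pow 2
    refine hd.congr_deriv ?_
    push_cast
    ring
  have hzero := hmin.hasDerivAt_eq_zero hderiv
  rw [← Finset.mul_sum] at hzero
  linarith

/-- Every fitted value of an isotonic regression lies between two observations. -/
theorem IsIsoProj.exists_le_and_exists_ge {T : ℕ} {v w g : Fin T → ℝ}
    (hg : IsIsoProj v w g) (t : Fin T) : (∃ s, w s ≤ g t) ∧ ∃ s, g t ≤ w s := by
  have hsum : ∑ s with g s = g t, w s = ∑ s with g s = g t, g s := by
    have h := hg.sum_comp_mul_residual_eq_zero fun x => if x = g t then 1 else 0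
    simp only [ite_mul, one_mul, zero_mul, ← Finset.sum_filter, Finset.sum_sub_distrib] at h
    exact sub_eq_zero.1 h
  have hne : (Finset.univ.filter fun s => g s = g t).Nonempty := ⟨t, by simp⟩
  obtain ⟨s, hs, hle⟩ := Finset.exists_le_of_sum_le hne hsum.le
  obtain ⟨s', hs', hge⟩ := Finset.exists_le_of_sum_le hne hsum.ge
  rw [Finset.mem_filter_univ] at hs hs'
  exact ⟨⟨s, hs ▸ hle⟩, ⟨s', hs' ▸ hge⟩⟩

/-- (Lipschitz lower bound for the isotonic residual, Lemma 6 of Dai et al.)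
⟨Xu*, f*(Xu*) − iso_{Xu}(f*(Xu*))⟩ ≥ L⁻¹·‖f*(Xu*) − iso_{Xu}(f*(Xu*))‖₂². -/
theorem lipschitz_iso_residual_lower {T M : ℕ} (X : Fin T → Fin M → ℝ)
    (ustar u : Fin M → ℝ) (f : ℝ → ℝ) (L : ℝ)
    (hfmono : Monotone f)
    (hflip : ∀ a b : ℝ, |f a - f b| ≤ L * |a - b|)
    (g : Fin T → ℝ)
    (hg : IsIsoProj (fun t => ∑ i, X t i * u i) (fun t => f (∑ i, X t i * ustar i)) g) :
    L⁻¹ * ∑ t, (f (∑ i, X t i * ustar i) - g t) ^ 2 ≤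
      ∑ t, (∑ i, X t i * ustar i) * (f (∑ i, X t i * ustar i) - g t) := by
  have hcont : Continuous f :=
    (LipschitzWith.of_dist_le' fun a b => by simpa [Real.dist_eq] using hflip a b).continuous
  have hrange : ∀ t, ∃ c, f c = g t := fun t => by
    obtain ⟨⟨s, hs⟩, s', hs'⟩ := hg.exists_le_and_exists_ge t
    exact mem_range_of_exists_le_of_exists_ge hcont ⟨_, hs⟩ ⟨_, hs'⟩
  have horth := hg.sum_comp_mul_residual_eq_zero (Function.invFun f)
  rw [Finset.mul_sum, ← sub_zero (∑ t, (∑ i, X t i * ustar i) * _), ← horth,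
    ← Finset.sum_sub_distrib]
  refine Finset.sum_le_sum fun t _ => ?_
  have h := inv_mul_sq_sub_le_of_monotone_lipschitz hfmono hflip (∑ i, X t i * ustar i)
    (Function.invFun f (g t))
  rwa [Function.invFun_eq (hrange t), sub_mul] at h
end
end
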